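/- For the Gegenbauer multipliers η_k^t = C_k^{(m−1)/2}(cos t)/C_k^{(m−1)/2}(1) of the shifting operator on Sᵐ (m ≥ 2), one has 1 − η_k^t ≍ (min{1, kt})² for k ≥ 0 and t ∈ (0,π/2]: there exist positive constants c₁, c₂ (depending only on m) with c₁ (min{1,kt})² ≤ 1 − η_k^t ≤ c₂ (min{1,kt})². -/

import Mathlib

open scoped Real

/-- The Gegenbauer (ultraspherical) polynomials `C_k^λ`, defined by the standard
recurrence `C_0^λ = 1`, `C_1^λ = 2λx`, `k C_k^λ = 2(k−1+λ) x C_{k−1}^λ − (k−2+2λ) C_{k−2}^λ`. -/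
noncomputable def gegenbauer (lam : ℝ) : ℕ → Polynomial ℝ
  | 0 => 1
  | 1 => Polynomial.C (2 * lam) * Polynomial.X
  | (n + 2) =>
      Polynomial.C (((n : ℝ) + 2)⁻¹) *
        (Polynomial.C (2 * ((n : ℝ) + 1 + lam)) * Polynomial.X * gegenbauer lam (n + 1) -
          Polynomial.C ((n : ℝ) + 2 * lam) * gegenbauer lam n)

/-- The Gegenbauer polynomial divided by its value at `1`. -/
noncomputable def normalizedGegenbauer (lam : ℝ) (k : ℕ) (x : ℝ) : ℝ :=
  (gegenbauer lam k).eval x / (gegenbauer lam k).eval 1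

lemma gegenbauer_eval_add_two (lam : ℝ) (k : ℕ) (x : ℝ) :
    ((k : ℝ) + 2) * (gegenbauer lam (k + 2)).eval x =
      2 * ((k : ℝ) + 1 + lam) * x * (gegenbauer lam (k + 1)).eval x -
        ((k : ℝ) + 2 * lam) * (gegenbauer lam k).eval x := by
  have hk : (k : ℝ) + 2 ≠ 0 := by positivity
  simp only [gegenbauer, Polynomial.eval_mul, Polynomial.eval_sub, Polynomial.eval_C,
    Polynomial.eval_X]
  field_simp

lemma gegenbauer_eval_one_succ (lam : ℝ) (k : ℕ) :
    ((k : ℝ) + 1) * (gegenbauer lam (k + 1)).eval 1 =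
      ((k : ℝ) + 2 * lam) * (gegenbauer lam k).eval 1 := by
  induction k with
  | zero => simp [gegenbauer]
  | succ k ih =>
    have h := gegenbauer_eval_add_two lam k 1
    push_cast
    linear_combination h + ih

lemma gegenbauer_eval_one_pos {lam : ℝ} (hlam : 0 < lam) (k : ℕ) :
    0 < (gegenbauer lam k).eval 1 := by
  induction k with
  | zero => simp [gegenbauer]
  | succ k ih =>
    have h : 0 < ((k : ℝ) + 1) * (gegenbauer lam (k + 1)).eval 1 := by
      rw [gegenbauer_eval_one_succ]
      positivity
    exact pos_of_mul_pos_right h (by positivity)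

namespace normalizedGegenbauer

variable {lam x : ℝ}

@[simp]
lemma zero : normalizedGegenbauer lam 0 x = 1 := by
  simp [normalizedGegenbauer, gegenbauer]

lemma one (hlam : 0 < lam) : normalizedGegenbauer lam 1 x = x := by
  simp [normalizedGegenbauer, gegenbauer, hlam.ne']

lemma add_two (hlam : 0 < lam) (k : ℕ) :
    ((k : ℝ) + 1 + 2 * lam) * normalizedGegenbauer lam (k + 2) x =
      2 * ((k : ℝ) + 1 + lam) * x * normalizedGegenbauer lam (k + 1) x -
        ((k : ℝ) + 1) * normalizedGegenbauer lam k x := by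
  have h0 := gegenbauer_eval_one_pos hlam k
  have h1 := gegenbauer_eval_one_pos hlam (k + 1)
  have h2 := gegenbauer_eval_one_pos hlam (k + 2)
  have e1 := gegenbauer_eval_one_succ lam k
  have e2 := gegenbauer_eval_one_succ lam (k + 1)
  have e := gegenbauer_eval_add_two lam k x
  push_cast at e2
  have hk : (k : ℝ) + 2 * lam ≠ 0 := by positivity
  have hk' : (k : ℝ) + 1 + 2 * lam ≠ 0 := by positivity
  have r2 : ((k : ℝ) + 1 + 2 * lam) * normalizedGegenbauer lam (k + 2) x =
      ((k : ℝ) + 2) * (gegenbauer lam (k + 2)).eval x / (gegenbauer lam (k + 1)).eval 1 := by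
    rw [normalizedGegenbauer, ← mul_div_assoc, div_eq_div_iff h2.ne' h1.ne']
    linear_combination -(gegenbauer lam (k + 2)).eval x * e2
  have r0 : ((k : ℝ) + 1) * normalizedGegenbauer lam k x =
      ((k : ℝ) + 2 * lam) * (gegenbauer lam k).eval x / (gegenbauer lam (k + 1)).eval 1 := by
    rw [normalizedGegenbauer, ← mul_div_assoc, div_eq_div_iff h0.ne' h1.ne']
    linear_combination (gegenbauer lam k).eval x * e1
  rw [r2, r0, e, normalizedGegenbauer]
  ring

/-- A discrete energy of the recurrence; it is nonincreasing in `k` (see `energy_succ`). -/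
noncomputable def energy (lam : ℝ) (k : ℕ) (x : ℝ) : ℝ :=
  normalizedGegenbauer lam k x ^ 2 -
    2 * x * normalizedGegenbauer lam k x * normalizedGegenbauer lam (k + 1) x +
      normalizedGegenbauer lam (k + 1) x ^ 2

lemma energy_zero (hlam : 0 < lam) : energy lam 0 x = 1 - x ^ 2 := by
  simp [energy, one hlam]
  ring

lemma energy_succ (hlam : 0 < lam) (k : ℕ) :
    energy lam (k + 1) x = energy lam k x - lam / ((k : ℝ) + 1 + lam) *
      (normalizedGegenbauer lam k x - normalizedGegenbauer lam (k + 2) x) ^ 2 := by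
  have h := add_two (x := x) hlam k
  have hk : (k : ℝ) + 1 + lam ≠ 0 := by positivity
  simp only [energy]
  field_simp
  linear_combination (normalizedGegenbauer lam (k + 2) x - normalizedGegenbauer lam k x) * h

lemma energy_antitone (hlam : 0 < lam) : Antitone fun k => energy lam k x := by
  refine antitone_nat_of_succ_le fun k => ?_
  rw [energy_succ hlam]
  have : 0 ≤ lam / ((k : ℝ) + 1 + lam) *
    (normalizedGegenbauer lam k x - normalizedGegenbauer lam (k + 2) x) ^ 2 := by positivity
  linarith

lemma mul_sq_succ_le_energy (k : ℕ) :
    (1 - x ^ 2) * normalizedGegenbauer lam (k + 1) x ^ 2 ≤ energy lam k x := by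
  rw [energy]
  nlinarith [sq_nonneg (normalizedGegenbauer lam k x - x * normalizedGegenbauer lam (k + 1) x)]

lemma abs_le_one (hlam : 0 < lam) (hx0 : 0 ≤ x) (hx1 : x < 1) (k : ℕ) :
    |normalizedGegenbauer lam k x| ≤ 1 := by
  cases k with
  | zero => simp
  | succ k =>
    have h1 := mul_sq_succ_le_energy (lam := lam) (x := x) k
    have h2 : energy lam k x ≤ energy lam 0 x := energy_antitone hlam k.zero_le
    rw [energy_zero hlam] at h2
    have hx : 0 < 1 - x ^ 2 := by nlinarith
    exact (sq_le_one_iff_abs_le_one _).mp (le_of_mul_le_mul_left (by linarith) hx)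

lemma sub_succ (hlam : 0 < lam) (k : ℕ) :
    ((k : ℝ) + 1 + 2 * lam) *
        (normalizedGegenbauer lam (k + 1) x - normalizedGegenbauer lam (k + 2) x) =
      ((k : ℝ) + 1) * (normalizedGegenbauer lam k x - normalizedGegenbauer lam (k + 1) x) +
        2 * ((k : ℝ) + 1 + lam) * (1 - x) * normalizedGegenbauer lam (k + 1) x := by
  linear_combination -add_two (x := x) hlam k

lemma sub_succ_le (hlam : 0 < lam) (hx0 : 0 ≤ x) (hx1 : x < 1) (k : ℕ) :
    normalizedGegenbauer lam k x - normalizedGegenbauer lam (k + 1) x ≤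
      (2 * (k : ℝ) + 1) * (1 - x) := by
  induction k with
  | zero => simp [one hlam]
  | succ k ih =>
    have h := sub_succ (x := x) hlam k
    have hR := (abs_le.mp (abs_le_one hlam hx0 hx1 (k + 1))).2
    have hk : (0 : ℝ) < (k : ℝ) + 1 + 2 * lam := by positivity
    refine le_of_mul_le_mul_left ?_ hk
    rw [h]
    push_cast
    have a1 := mul_le_mul_of_nonneg_left ih (by positivity : (0 : ℝ) ≤ (k : ℝ) + 1)
    have a2 := mul_le_mul_of_nonneg_left hR
      (by have : 0 < 1 - x := by linarith
          positivity : (0 : ℝ) ≤ 2 * ((k : ℝ) + 1 + lam) * (1 - x))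
    have a3 : 0 ≤ 4 * lam * ((k : ℝ) + 1) * (1 - x) :=
      mul_nonneg (by positivity) (by linarith)
    linarith

lemma one_sub_le (hlam : 0 < lam) (hx0 : 0 ≤ x) (hx1 : x < 1) (k : ℕ) :
    1 - normalizedGegenbauer lam k x ≤ (k : ℝ) ^ 2 * (1 - x) := by
  induction k with
  | zero => simp
  | succ k ih =>
    have := sub_succ_le hlam hx0 hx1 k
    push_cast
    linarith

lemma le_sub_succ (hlam : 0 < lam) (hx0 : 0 ≤ x) (hx1 : x < 1) (k : ℕ)
    (hk : (k : ℝ) ^ 2 * (1 - x) ≤ 1 / 2) :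
    (2 * (k : ℝ) + 1) * (1 - x) / (2 + 4 * lam) ≤
      normalizedGegenbauer lam k x - normalizedGegenbauer lam (k + 1) x := by
  have hx : 0 < 1 - x := by linarith
  induction k with
  | zero =>
    simp only [zero, one hlam, zero_add]
    rw [div_le_iff₀ (by positivity)]
    push_cast
    nlinarith
  | succ k ih =>
    push_cast at hk
    have hk' : (k : ℝ) ^ 2 * (1 - x) ≤ 1 / 2 := by
      refine le_trans ?_ hk
      gcongr
      linarith
    have hR := one_sub_le hlam hx0 hx1 (k + 1)
    push_cast at hR
    have hR' : 1 / 2 ≤ normalizedGegenbauer lam (k + 1) x := by linarith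
    have hpos : (0 : ℝ) < (k : ℝ) + 1 + 2 * lam := by positivity
    refine le_of_mul_le_mul_left ?_ hpos
    rw [sub_succ hlam k]
    have a1 := mul_le_mul_of_nonneg_left (ih hk') (by positivity : (0 : ℝ) ≤ (k : ℝ) + 1)
    have a2 := mul_le_mul_of_nonneg_left hR'
      (by positivity : (0 : ℝ) ≤ 2 * ((k : ℝ) + 1 + lam) * (1 - x))
    refine le_trans ?_ (add_le_add a1 a2)
    have a3 : 0 ≤ 4 * lam ^ 2 * (1 - x) := by positivity
    push_cast
    field_simp
    nlinarith

lemma le_one_sub (hlam : 0 < lam) (hx0 : 0 ≤ x) (hx1 : x < 1) (k : ℕ)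
    (hk : (k : ℝ) ^ 2 * (1 - x) ≤ 1 / 2) :
    (k : ℝ) ^ 2 * (1 - x) / (2 + 4 * lam) ≤ 1 - normalizedGegenbauer lam k x := by
  have hx : 0 < 1 - x := by linarith
  induction k with
  | zero => simp
  | succ k ih =>
    have hk' : (k : ℝ) ^ 2 * (1 - x) ≤ 1 / 2 := by
      refine le_trans ?_ hk
      push_cast
      gcongr
      linarith
    have h1 := ih hk'
    have h2 := le_sub_succ hlam hx0 hx1 k hk'
    have h3 := add_le_add h1 h2
    have e : ((k + 1 : ℕ) : ℝ) ^ 2 * (1 - x) / (2 + 4 * lam) =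
        (k : ℝ) ^ 2 * (1 - x) / (2 + 4 * lam) +
          (2 * (k : ℝ) + 1) * (1 - x) / (2 + 4 * lam) := by
      push_cast
      ring
    linarith

lemma energy_le (hlam : 0 < lam) (hx0 : 0 ≤ x) (hx1 : x < 1) (k : ℕ)
    (hk : (k : ℝ) ^ 2 * (1 - x) ≤ 1 / 2) :
    energy lam k x ≤ 1 - x ^ 2 -
      8 * lam / ((1 + lam) * (2 + 4 * lam) ^ 2) * (1 - x) ^ 2 * ((k : ℝ) * ((k : ℝ) + 1)) := by
  have hx : 0 < 1 - x := by linarith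
  induction k with
  | zero => simp [energy_zero hlam]
  | succ k ih =>
    have hk' : (k : ℝ) ^ 2 * (1 - x) ≤ 1 / 2 := by
      refine le_trans ?_ hk
      push_cast
      gcongr
      linarith
    have d0 := le_sub_succ hlam hx0 hx1 k hk'
    have d1 := le_sub_succ hlam hx0 hx1 (k + 1) hk
    have d : 4 * ((k : ℝ) + 1) * (1 - x) / (2 + 4 * lam) ≤
        normalizedGegenbauer lam k x - normalizedGegenbauer lam (k + 2) x := by
      have e : 4 * ((k : ℝ) + 1) * (1 - x) / (2 + 4 * lam) =
          (2 * (k : ℝ) + 1) * (1 - x) / (2 + 4 * lam) +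
            (2 * ((k + 1 : ℕ) : ℝ) + 1) * (1 - x) / (2 + 4 * lam) := by
        push_cast
        ring
      linarith
    have dsq := pow_le_pow_left₀ (by positivity) d 2
    have hc : lam / (((k : ℝ) + 1) * (1 + lam)) ≤ lam / ((k : ℝ) + 1 + lam) := by
      gcongr
      nlinarith [mul_nonneg k.cast_nonneg (α := ℝ) hlam.le]
    have hprod := mul_le_mul hc dsq (by positivity) (by positivity)
    rw [energy_succ hlam]
    have e : lam / (((k : ℝ) + 1) * (1 + lam)) *
        (4 * ((k : ℝ) + 1) * (1 - x) / (2 + 4 * lam)) ^ 2 =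
        8 * lam / ((1 + lam) * (2 + 4 * lam) ^ 2) * (1 - x) ^ 2 * (2 * ((k : ℝ) + 1)) := by
      field_simp
      ring
    rw [e] at hprod
    push_cast
    linarith [ih hk']

lemma energy_one_le (hlam : 0 < lam) (hx0 : 0 ≤ x) (hx1 : x < 1) :
    energy lam 1 x ≤ (1 - x ^ 2) - lam / (1 + lam) * (1 - x ^ 2) ^ 2 := by
  have hx : 0 < 1 - x ^ 2 := by nlinarith
  have h := energy_succ (x := x) hlam 0
  have h2 := add_two (x := x) hlam 0
  simp only [energy_zero hlam, Nat.cast_zero, zero_add, zero, one hlam] at h h2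
  have h3 : 1 - x ^ 2 ≤ 1 - normalizedGegenbauer lam 2 x := by
    refine le_of_mul_le_mul_left ?_ (by positivity : 0 < 1 + 2 * lam)
    nlinarith
  rw [h]
  gcongr

/-- Once `k ^ 2 * (1 - x)` is not small, the normalized polynomial stays away from `1`. -/
lemma exists_le_one_sub (hlam : 0 < lam) :
    ∃ c > (0 : ℝ), ∀ x : ℝ, 0 ≤ x → x < 1 → ∀ k : ℕ, 1 / 2 < (k : ℝ) ^ 2 * (1 - x) →
      c ≤ 1 - normalizedGegenbauer lam k x := by
  set a := 8 * lam / ((1 + lam) * (2 + 4 * lam) ^ 2) with ha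
  have ha0 : 0 < a := by positivity
  have hb0 : 0 < lam / (1 + lam) := by positivity
  have hb1 : lam / (1 + lam) < 1 := by rw [div_lt_one (by positivity)]; linarith
  refine ⟨min (a / 16) (lam / (1 + lam) / 4), lt_min (by positivity) (by positivity),
    fun x hx0 hx1 k hk => ?_⟩
  have hx : 0 < 1 - x := by linarith
  have hxx : 0 < 1 - x ^ 2 := by nlinarith
  -- a drop of the energy at an earlier index forces a gap at `k`
  have gap : ∀ n : ℕ, n + 1 ≤ k → ∀ b : ℝ, energy lam n x ≤ (1 - x ^ 2) - b * (1 - x ^ 2) →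
      b / 2 ≤ 1 - normalizedGegenbauer lam k x := by
    intro n hn b hb
    obtain ⟨j, rfl⟩ : ∃ j, k = j + 1 := ⟨k - 1, by omega⟩
    have h1 := mul_sq_succ_le_energy (lam := lam) (x := x) j
    have h2 : energy lam j x ≤ energy lam n x := energy_antitone hlam (by omega)
    have h3 : normalizedGegenbauer lam (j + 1) x ^ 2 ≤ 1 - b :=
      le_of_mul_le_mul_left (by linarith) hxx
    nlinarith [sq_nonneg (1 - normalizedGegenbauer lam (j + 1) x)]
  classical
  have hex : ∃ n : ℕ, 1 / 2 < (n : ℝ) ^ 2 * (1 - x) := ⟨k, hk⟩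
  have hn := Nat.find_spec hex
  have hnk : Nat.find hex ≤ k := Nat.find_min' hex hk
  have hmin := fun j => Nat.find_min hex (m := j)
  generalize Nat.find hex = n at hn hnk hmin
  match n, hn, hnk, hmin with
  | 0, hn, _, _ => norm_num at hn
  | 1, hn, hnk, _ =>
    refine (min_le_right _ _).trans ?_
    have hn' : 1 / 2 < 1 - x := by simpa using hn
    obtain rfl | hk2 := hnk.eq_or_lt
    · rw [one hlam]
      linarith
    · have h := gap 1 hk2 (lam / (1 + lam) * (1 - x ^ 2)) (by
        have := energy_one_le hlam hx0 hx1
        linarith)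
      refine le_trans ?_ h
      have : 1 / 2 ≤ 1 - x ^ 2 := by nlinarith
      nlinarith
  | N + 2, hn, hnk, hmin =>
    refine (min_le_left _ _).trans ?_
    have hN := not_lt.mp (hmin (N + 1) (by omega))
    have hE := energy_le hlam hx0 hx1 (N + 1) hN
    rw [← ha] at hE
    push_cast at hE hn
    have hq : 1 / 4 ≤ (1 - x) * (((N : ℝ) + 1) * ((N : ℝ) + 1 + 1)) := by
      have hN0 : (0 : ℝ) ≤ N := N.cast_nonneg
      have : 0 ≤ (N : ℝ) * ((N : ℝ) + 2) * (1 - x) := by positivity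
      nlinarith
    have h := gap (N + 1) hnk (a / 8) (by
      refine hE.trans ?_
      have h1 := mul_le_mul_of_nonneg_left hq (by positivity : 0 ≤ a * (1 - x))
      have h2 : a / 8 * (1 - x ^ 2) ≤ a * (1 - x) * (1 / 4) := by
        have : 0 ≤ a * (1 - x) ^ 2 := by positivity
        nlinarith
      linarith)
    linarith

end normalizedGegenbauer

open normalizedGegenbauer in
/-- Two-sided bound for the normalized Gegenbauer polynomials with any positive parameter. -/
lemma normalizedGegenbauer_cos_asymptotics {lam : ℝ} (hlam : 0 < lam) :
    ∃ c₁ > (0 : ℝ), ∃ c₂ > (0 : ℝ), ∀ k : ℕ, ∀ t ∈ Set.Ioc (0 : ℝ) (π / 2),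
      c₁ * (min 1 ((k : ℝ) * t)) ^ 2 ≤ 1 - normalizedGegenbauer lam k (Real.cos t) ∧
      1 - normalizedGegenbauer lam k (Real.cos t) ≤ c₂ * (min 1 ((k : ℝ) * t)) ^ 2 := by
  obtain ⟨c, hc, H⟩ := exists_le_one_sub hlam
  have hpi := Real.pi_pos
  refine ⟨min c (2 / π ^ 2 / (2 + 4 * lam)), lt_min hc (by positivity), 2, two_pos,
    fun k t ht => ?_⟩
  obtain ⟨ht0, ht1⟩ := ht
  have hx0 : 0 ≤ Real.cos t := Real.cos_nonneg_of_mem_Icc ⟨by linarith, ht1⟩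
  have hlow : 2 / π ^ 2 * t ^ 2 ≤ 1 - Real.cos t := by
    have := Real.cos_le_one_sub_mul_cos_sq (x := t) (by rw [abs_of_pos ht0]; linarith)
    linarith
  have hup : 1 - Real.cos t ≤ t ^ 2 / 2 := by
    linarith [Real.one_sub_sq_div_two_le_cos (x := t)]
  have hx1 : Real.cos t < 1 := by
    have : 0 < 2 / π ^ 2 * t ^ 2 := by positivity
    linarith
  have hmin0 : 0 ≤ min 1 ((k : ℝ) * t) := le_min zero_le_one (by positivity)
  have hmin1 : min 1 ((k : ℝ) * t) ^ 2 ≤ 1 := pow_le_one₀ hmin0 (min_le_left _ _)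
  have hmin2 : min 1 ((k : ℝ) * t) ^ 2 ≤ ((k : ℝ) * t) ^ 2 :=
    pow_le_pow_left₀ hmin0 (min_le_right _ _) 2
  constructor
  · rcases le_or_gt ((k : ℝ) ^ 2 * (1 - Real.cos t)) (1 / 2) with hk | hk
    · calc min c (2 / π ^ 2 / (2 + 4 * lam)) * min 1 ((k : ℝ) * t) ^ 2
          ≤ 2 / π ^ 2 / (2 + 4 * lam) * ((k : ℝ) * t) ^ 2 := by
            gcongr
            exact min_le_right _ _
        _ = (k : ℝ) ^ 2 * (2 / π ^ 2 * t ^ 2) / (2 + 4 * lam) := by ring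
        _ ≤ (k : ℝ) ^ 2 * (1 - Real.cos t) / (2 + 4 * lam) := by gcongr
        _ ≤ _ := le_one_sub hlam hx0 hx1 k hk
    · calc min c (2 / π ^ 2 / (2 + 4 * lam)) * min 1 ((k : ℝ) * t) ^ 2
          ≤ c * 1 := by
            gcongr
            exact min_le_left _ _
        _ ≤ _ := by simpa using H _ hx0 hx1 k hk
  · rcases le_total 1 ((k : ℝ) * t) with hk | hk
    · rw [min_eq_left hk]
      linarith [(abs_le.mp (abs_le_one hlam hx0 hx1 k)).1]
    · rw [min_eq_right hk]
      have h1 := one_sub_le hlam hx0 hx1 k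
      have h2 := mul_le_mul_of_nonneg_left hup (sq_nonneg (k : ℝ))
      nlinarith [sq_nonneg ((k : ℝ) * t)]

/-- For the Gegenbauer multipliers
`η_k^t = C_k^{(m−1)/2}(cos t)/C_k^{(m−1)/2}(1)` of the shifting operator on `Sᵐ`
(`m ≥ 2`), one has `1 − η_k^t ≍ (min{1, kt})²` for `k ≥ 0` and `t ∈ (0,π/2]`:
there exist `c₁, c₂ > 0` (depending only on `m`) with
`c₁ (min{1,kt})² ≤ 1 − η_k^t ≤ c₂ (min{1,kt})²`. -/
theorem gegenbauer_multiplier_asymptotics (m : ℕ) (hm : 2 ≤ m) :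
    ∃ c₁ > (0 : ℝ), ∃ c₂ > (0 : ℝ), ∀ k : ℕ, ∀ t ∈ Set.Ioc (0 : ℝ) (π / 2),
      c₁ * (min 1 ((k : ℝ) * t)) ^ 2 ≤
        1 - (gegenbauer (((m : ℝ) - 1) / 2) k).eval (Real.cos t) /
              (gegenbauer (((m : ℝ) - 1) / 2) k).eval 1 ∧
      1 - (gegenbauer (((m : ℝ) - 1) / 2) k).eval (Real.cos t) /
            (gegenbauer (((m : ℝ) - 1) / 2) k).eval 1 ≤
        c₂ * (min 1 ((k : ℝ) * t)) ^ 2 := by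
  have hlam : 0 < ((m : ℝ) - 1) / 2 := by
    have : (2 : ℝ) ≤ m := by exact_mod_cast hm
    linarith
  exact normalizedGegenbauer_cos_asymptotics hlam
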